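/- arXiv:2003.03478 — 2 statements merged into one kernel-verified Lean document; each statement's English description precedes it below -/
import Mathlib

section
/- Let L > 0 and Ra ∈ ℝ. Let a : ℤ³ → ℂ satisfy a(k) = 0 whenever k₁² + k₂² = 0 and Σ_{k∈ℤ³} |a(k)|² < ∞, and for k with k₁² + k₂² ≠ 0 define û(k) = Ra · (−(k₂/L) k₃ / (k₃² + κ_k³)) · a(k), v̂(k) = Ra · ((k₁/L) k₃ / (k₃² + κ_k³)) · a(k), and ŵ(k) = Ra · (κ_k² / (k₃² + κ_k³)) · a(k), all zero otherwise. Then Σ_{k∈ℤ³} |k₃|^{4/3} ( |û(k)|² + |v̂(k)|² ) ≤ Ra² Σ_{k∈ℤ³} |a(k)|² and Σ_{k∈ℤ³} |k₃|^{4/3} |ŵ(k)|² ≤ Ra² Σ_{k∈ℤ³} |a(k)|². -/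
noncomputable section
open Real

/-- For `k = (k₁,k₂,k₃) ∈ ℤ³`, `κ_k = (k₁² + k₂²)/L²`. -/
def kappa (L : ℝ) (k : ℤ × ℤ × ℤ) : ℝ := ((k.1^2 + k.2.1^2 : ℤ) : ℝ) / L^2

/-- Young-type bound for the horizontal velocity multiplier. -/
theorem pow_five_mul_le_sq_add_cube {t c : ℝ} (ht : 0 ≤ t) (hc : 0 ≤ c) :
    t ^ 5 * c ≤ (t ^ 3 + c ^ 3) ^ 2 := by
  rcases le_total c t with h | h
  · have h1 : t ^ 5 * c ≤ t ^ 5 * t := by gcongr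
    have h2 : 0 ≤ 2 * t ^ 3 * c ^ 3 + c ^ 6 := by positivity
    nlinarith
  · have h1 : t ^ 5 * c ≤ c ^ 5 * c := by gcongr
    have h2 : 0 ≤ 2 * t ^ 3 * c ^ 3 + t ^ 6 := by positivity
    nlinarith

/-- Young-type bound for the vertical velocity multiplier. -/
theorem sq_mul_pow_four_le_sq_add_cube {t c : ℝ} (ht : 0 ≤ t) (hc : 0 ≤ c) :
    t ^ 2 * c ^ 4 ≤ (t ^ 3 + c ^ 3) ^ 2 := by
  rcases le_total c t with h | h
  · have h1 : t ^ 2 * c ^ 4 ≤ t ^ 2 * t ^ 4 := by gcongr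
    have h2 : 0 ≤ 2 * t ^ 3 * c ^ 3 + c ^ 6 := by positivity
    nlinarith
  · have h1 : t ^ 2 * c ^ 4 ≤ c ^ 2 * c ^ 4 := by gcongr
    have h2 : 0 ≤ 2 * t ^ 3 * c ^ 3 + t ^ 6 := by positivity
    nlinarith

theorem abs_rpow_four_thirds_eq_sq (m : ℝ) :
    |m| ^ ((4:ℝ)/3) = (|m| ^ ((2:ℝ)/3)) ^ 2 := by
  rw [← Real.rpow_mul_natCast (abs_nonneg m)]
  norm_num

theorem sq_eq_abs_rpow_two_thirds_cube (m : ℝ) :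
    m ^ 2 = (|m| ^ ((2:ℝ)/3)) ^ 3 := by
  rw [← Real.rpow_mul_natCast (abs_nonneg m)]
  norm_num

theorem abs_rpow_mul_horizontal_multiplier_le_one (m : ℝ) {c : ℝ} (hc : 0 < c) :
    |m| ^ ((4:ℝ)/3) * (c * m ^ 2 / (m ^ 2 + c ^ 3) ^ 2) ≤ 1 := by
  have ht : 0 ≤ |m| ^ ((2:ℝ)/3) := by positivity
  rw [sq_eq_abs_rpow_two_thirds_cube m, abs_rpow_four_thirds_eq_sq, ← mul_div_assoc,
    div_le_one (by positivity)]
  linarith [pow_five_mul_le_sq_add_cube ht hc.le]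

theorem abs_rpow_mul_vertical_multiplier_le_one (m : ℝ) {c : ℝ} (hc : 0 < c) :
    |m| ^ ((4:ℝ)/3) * (c ^ 2 / (m ^ 2 + c ^ 3)) ^ 2 ≤ 1 := by
  have ht : 0 ≤ |m| ^ ((2:ℝ)/3) := by positivity
  rw [sq_eq_abs_rpow_two_thirds_cube m, abs_rpow_four_thirds_eq_sq, div_pow, ← mul_div_assoc,
    div_le_one (by positivity)]
  linarith [sq_mul_pow_four_le_sq_add_cube ht hc.le]

theorem kappa_pos {L : ℝ} (hL : 0 < L) {k : ℤ × ℤ × ℤ} (hk : k.1^2 + k.2.1^2 ≠ 0) :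
    0 < kappa L k := by
  have h : 0 < k.1^2 + k.2.1^2 := lt_of_le_of_ne (by positivity) hk.symm
  have h' : (0:ℝ) < ((k.1^2 + k.2.1^2 : ℤ) : ℝ) := by exact_mod_cast h
  unfold kappa
  positivity

theorem norm_ofReal_mul_sq (r : ℝ) (z : ℂ) : ‖(r : ℂ) * z‖ ^ 2 = r ^ 2 * ‖z‖ ^ 2 := by
  rw [norm_mul, mul_pow, Complex.norm_real, Real.norm_eq_abs, sq_abs]

theorem tsum_le_mul_tsum_of_le {ι : Type*} {f g : ι → ℝ} {C : ℝ} (hf : ∀ i, 0 ≤ f i)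
    (hfg : ∀ i, f i ≤ C * g i) (hg : Summable g) : ∑' i, f i ≤ C * ∑' i, g i := by
  rw [← tsum_mul_left]
  exact (Summable.of_nonneg_of_le hf hfg (hg.mul_left C)).tsum_le_tsum hfg (hg.mul_left C)

/-- Fourier-coefficient form of the fractional-derivative estimates
`‖∂_z^{2/3} u‖₂² ≤ Ra² ‖θ'‖₂²` and `‖∂_z^{2/3} w‖₂² ≤ Ra² ‖θ'‖₂²`. -/
theorem dz_twothirds_velocity_estimate (L Ra : ℝ) (hL : 0 < L)
    (a u v w : ℤ × ℤ × ℤ → ℂ)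
    (ha0 : ∀ k : ℤ × ℤ × ℤ, k.1^2 + k.2.1^2 = 0 → a k = 0)
    (ha : Summable fun k : ℤ × ℤ × ℤ => ‖a k‖^2)
    (hu : ∀ k : ℤ × ℤ × ℤ, u k =
      if k.1^2 + k.2.1^2 ≠ 0 then
        ((Ra * (-((k.2.1:ℝ)/L) * (k.2.2:ℝ) / (((k.2.2:ℝ))^2 + kappa L k ^ 3)) : ℝ) : ℂ) * a k
      else 0)
    (hv : ∀ k : ℤ × ℤ × ℤ, v k =
      if k.1^2 + k.2.1^2 ≠ 0 then
        ((Ra * (((k.1:ℝ)/L) * (k.2.2:ℝ) / (((k.2.2:ℝ))^2 + kappa L k ^ 3)) : ℝ) : ℂ) * a k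
      else 0)
    (hw : ∀ k : ℤ × ℤ × ℤ, w k =
      if k.1^2 + k.2.1^2 ≠ 0 then
        ((Ra * (kappa L k ^ 2 / (((k.2.2:ℝ))^2 + kappa L k ^ 3)) : ℝ) : ℂ) * a k
      else 0) :
    (∑' k : ℤ × ℤ × ℤ, |(k.2.2:ℝ)| ^ ((4:ℝ)/3) * (‖u k‖^2 + ‖v k‖^2)
        ≤ Ra^2 * ∑' k : ℤ × ℤ × ℤ, ‖a k‖^2) ∧
    (∑' k : ℤ × ℤ × ℤ, |(k.2.2:ℝ)| ^ ((4:ℝ)/3) * ‖w k‖^2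
        ≤ Ra^2 * ∑' k : ℤ × ℤ × ℤ, ‖a k‖^2) := by
  constructor
  · refine tsum_le_mul_tsum_of_le (fun k => by positivity) (fun k => ?_) ha
    rw [hu, hv]
    split_ifs with hk
    · have hc := kappa_pos hL hk
      have hsum : ((k.2.1:ℝ) / L) ^ 2 + ((k.1:ℝ) / L) ^ 2 = kappa L k := by
        unfold kappa
        push_cast
        ring
      have key := abs_rpow_mul_horizontal_multiplier_le_one (k.2.2:ℝ) hc
      rw [norm_ofReal_mul_sq, norm_ofReal_mul_sq]
      generalize (k.2.2:ℝ) ^ 2 + kappa L k ^ 3 = d at key ⊢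
      calc _ = (Ra ^ 2 * ‖a k‖ ^ 2) * (|(k.2.2:ℝ)| ^ ((4:ℝ)/3) *
              (kappa L k * (k.2.2:ℝ) ^ 2 / d ^ 2)) := by
            rw [← hsum]
            ring
        _ ≤ (Ra ^ 2 * ‖a k‖ ^ 2) * 1 := by gcongr
        _ = _ := mul_one _
    · simp only [norm_zero]
      norm_num
      positivity
  · refine tsum_le_mul_tsum_of_le (fun k => by positivity) (fun k => ?_) ha
    rw [hw]
    split_ifs with hk
    · have key := abs_rpow_mul_vertical_multiplier_le_one (k.2.2:ℝ) (kappa_pos hL hk)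
      rw [norm_ofReal_mul_sq]
      calc _ = (Ra ^ 2 * ‖a k‖ ^ 2) * (|(k.2.2:ℝ)| ^ ((4:ℝ)/3) *
              (kappa L k ^ 2 / ((k.2.2:ℝ) ^ 2 + kappa L k ^ 3)) ^ 2) := by ring
        _ ≤ (Ra ^ 2 * ‖a k‖ ^ 2) * 1 := by gcongr
        _ = _ := mul_one _
    · simp only [norm_zero]
      norm_num
      positivity
end
end

section
/- There exists a constant C > 0, depending only on L, such that for all smooth Ω-periodic functions f, g : ℝ³ → ℝ one has ∫₀^{2π} ( \overline{f g}(z) )² dz ≤ C ( ‖f‖₂² + ‖∂_z f‖₂² ) ‖g‖₂², where \overline{f g}(z) = (1/(4π²L²)) ∫_{[0,2πL]²} f(x,y,z) g(x,y,z) dx dy. -/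
noncomputable section
open Real

/-- `f` is periodic with period `2πL` in the first two variables and `2π` in the third. -/
def OmegaPeriodic (L : ℝ) (f : ℝ → ℝ → ℝ → ℝ) : Prop :=
  (∀ x y z, f (x + 2*π*L) y z = f x y z) ∧
  (∀ x y z, f x (y + 2*π*L) z = f x y z) ∧
  (∀ x y z, f x y (z + 2*π) = f x y z)

/-- Smoothness of a function of three real variables. -/
def Smooth3 (f : ℝ → ℝ → ℝ → ℝ) : Prop :=
  ContDiff ℝ (⊤ : ℕ∞) (fun p : ℝ × ℝ × ℝ => f p.1 p.2.1 p.2.2)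

/-- Integral over the fundamental domain `Ω = [0,2πL]² × [0,2π]`. -/
def intOmega (L : ℝ) (g : ℝ → ℝ → ℝ → ℝ) : ℝ :=
  ∫ z in (0:ℝ)..(2*π), ∫ y in (0:ℝ)..(2*π*L), ∫ x in (0:ℝ)..(2*π*L), g x y z

def pdz (f : ℝ → ℝ → ℝ → ℝ) (x y z : ℝ) : ℝ := deriv (fun s => f x y s) z

/-- Squared `L²(Ω)` norm. -/
def l2sq (L : ℝ) (f : ℝ → ℝ → ℝ → ℝ) : ℝ := intOmega L (fun x y z => (f x y z)^2)

/-- The horizontal mean of `f` at height `z`. -/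
def hmean (L : ℝ) (f : ℝ → ℝ → ℝ → ℝ) (z : ℝ) : ℝ :=
  (1/(4*π^2*L^2)) * ∫ y in (0:ℝ)..(2*π*L), ∫ x in (0:ℝ)..(2*π*L), f x y z

/-- A one-dimensional Sobolev bound: the pointwise square of a `C¹` function on `[0,T]` is
controlled by its squared `H¹` norm. -/
theorem sq_le_sobolev_integral {h h' : ℝ → ℝ} (hd : ∀ s, HasDerivAt h (h' s) s)
    (hc' : Continuous h') {T : ℝ} (hT : 0 < T) {z : ℝ} (hz : z ∈ Set.Icc 0 T) :
    (h z)^2 ≤ (1/T + 1) * ∫ s in (0:ℝ)..T, ((h s)^2 + (h' s)^2) := by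
  have hc : Continuous h := continuous_iff_continuousAt.2 fun s => (hd s).continuousAt
  set A := ∫ s in (0:ℝ)..T, ((h s)^2 + (h' s)^2)
  have hsum : Continuous fun s => (h s)^2 + (h' s)^2 := by fun_prop
  have hdiff : ∀ w ∈ Set.Icc 0 T, (h z)^2 ≤ (h w)^2 + A := by
    intro w hw
    have hftc : ∫ s in w..z, 2 * h s * h' s = (h z)^2 - (h w)^2 := by
      apply intervalIntegral.integral_eq_sub_of_hasDerivAt (f := fun s => (h s)^2)
      · intro s _
        simpa using (hd s).fun_pow 2
      · exact Continuous.intervalIntegrable (by fun_prop) _ _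
    have habs : |∫ s in w..z, 2 * h s * h' s| ≤ |∫ s in w..z, ((h s)^2 + (h' s)^2)| := by
      rw [← norm_eq_abs (∫ s in w..z, 2 * h s * h' s)]
      apply intervalIntegral.norm_integral_le_abs_of_norm_le
      · refine Filter.Eventually.of_forall fun s => ?_
        rw [norm_eq_abs, abs_le]
        constructor <;> nlinarith [sq_nonneg (h s + h' s), sq_nonneg (h s - h' s)]
      · exact hsum.intervalIntegrable _ _
    have hmono : |∫ s in w..z, ((h s)^2 + (h' s)^2)| ≤ |A| := by
      apply intervalIntegral.abs_integral_mono_interval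
      · rw [Set.uIoc_of_le hT.le]
        exact Set.Ioc_subset_Ioc (le_min hw.1 hz.1) (max_le hw.2 hz.2)
      · exact Filter.Eventually.of_forall fun s => by positivity
      · exact hsum.intervalIntegrable _ _
    have hA0 : 0 ≤ A := intervalIntegral.integral_nonneg hT.le fun s _ => by positivity
    rw [abs_of_nonneg hA0] at hmono
    linarith [le_abs_self (∫ s in w..z, 2 * h s * h' s)]
  have hint : ∫ _ in (0:ℝ)..T, (h z)^2 ≤ ∫ w in (0:ℝ)..T, ((h w)^2 + A) :=
    intervalIntegral.integral_mono_on hT.le (by simp)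
      (Continuous.intervalIntegrable (by fun_prop) _ _) hdiff
  rw [intervalIntegral.integral_add (Continuous.intervalIntegrable (by fun_prop) _ _) (by simp),
    intervalIntegral.integral_const, intervalIntegral.integral_const] at hint
  have hle : ∫ w in (0:ℝ)..T, (h w)^2 ≤ A :=
    intervalIntegral.integral_mono_on hT.le (Continuous.intervalIntegrable (by fun_prop) _ _)
      (hsum.intervalIntegrable _ _) fun s _ => by nlinarith [sq_nonneg (h' s)]
  simp only [sub_zero, smul_eq_mul] at hint
  have hfin : T * (h z)^2 ≤ T * ((1/T + 1) * A) := by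
    have : T * ((1/T + 1) * A) = A + T * A := by field_simp
    linarith
  exact le_of_mul_le_mul_left hfin hT

/-- Continuity in a parameter of an integral over a rectangle. -/
theorem continuous_parametric_integral_rectangle {X : Type*} [TopologicalSpace X]
    {u : X → ℝ → ℝ → ℝ} (hu : Continuous fun p : (X × ℝ) × ℝ => u p.1.1 p.1.2 p.2) (a b c d : ℝ) :
    Continuous fun q => ∫ y in a..b, ∫ x in c..d, u q y x := by
  apply intervalIntegral.continuous_parametric_intervalIntegral_of_continuous'
  exact intervalIntegral.continuous_parametric_intervalIntegral_of_continuous'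
    (f := fun (p : X × ℝ) x => u p.1 p.2 x) hu _ _

theorem intervalIntegrable_inner {u : ℝ → ℝ → ℝ} (hu : Continuous u.uncurry) (a b c d : ℝ) :
    IntervalIntegrable (fun y => ∫ x in c..d, u y x) MeasureTheory.volume a b :=
  (intervalIntegral.continuous_parametric_intervalIntegral_of_continuous' hu c d).intervalIntegrable
    a b

theorem integral_rectangle_add {u v : ℝ → ℝ → ℝ} (hu : Continuous u.uncurry)
    (hv : Continuous v.uncurry) (a b c d : ℝ) :
    ∫ y in a..b, ∫ x in c..d, (u y x + v y x) =
      (∫ y in a..b, ∫ x in c..d, u y x) + ∫ y in a..b, ∫ x in c..d, v y x := by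
  rw [← intervalIntegral.integral_add (intervalIntegrable_inner hu a b c d)
    (intervalIntegrable_inner hv a b c d)]
  refine intervalIntegral.integral_congr fun y _ => ?_
  exact intervalIntegral.integral_add
    ((hu.comp (Continuous.prodMk_right y)).intervalIntegrable c d)
    ((hv.comp (Continuous.prodMk_right y)).intervalIntegrable c d)

theorem integral_rectangle_mono {u v : ℝ → ℝ → ℝ} (hu : Continuous u.uncurry)
    (hv : Continuous v.uncurry) {a b c d : ℝ} (hab : a ≤ b) (hcd : c ≤ d)
    (h : ∀ y x, u y x ≤ v y x) :
    ∫ y in a..b, ∫ x in c..d, u y x ≤ ∫ y in a..b, ∫ x in c..d, v y x :=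
  intervalIntegral.integral_mono hab (intervalIntegrable_inner hu a b c d)
    (intervalIntegrable_inner hv a b c d) fun y => intervalIntegral.integral_mono hcd
      ((hu.comp (Continuous.prodMk_right y)).intervalIntegrable c d)
      ((hv.comp (Continuous.prodMk_right y)).intervalIntegrable c d) (h y)

/-- Cauchy–Schwarz for continuous functions on a rectangle. -/
theorem sq_integral_rectangle_mul_le {u v : ℝ → ℝ → ℝ} (hu : Continuous u.uncurry)
    (hv : Continuous v.uncurry) {a b c d : ℝ} (hab : a ≤ b) (hcd : c ≤ d) :
    (∫ y in a..b, ∫ x in c..d, u y x * v y x)^2 ≤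
      (∫ y in a..b, ∫ x in c..d, (u y x)^2) * ∫ y in a..b, ∫ x in c..d, (v y x)^2 := by
  have hu' : Continuous fun p : ℝ × ℝ => u p.1 p.2 := hu
  have hv' : Continuous fun p : ℝ × ℝ => v p.1 p.2 := hv
  have key := discrim_le_zero (a := ∫ y in a..b, ∫ x in c..d, (u y x)^2)
    (b := 2 * ∫ y in a..b, ∫ x in c..d, u y x * v y x)
    (c := ∫ y in a..b, ∫ x in c..d, (v y x)^2) fun t => by
    have hnonneg : 0 ≤ ∫ y in a..b, ∫ x in c..d,
        ((t * t) * (u y x)^2 + ((2 * t) * (u y x * v y x) + (v y x)^2)) :=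
      intervalIntegral.integral_nonneg hab fun y _ =>
        intervalIntegral.integral_nonneg hcd fun x _ => by
          nlinarith [sq_nonneg (t * u y x + v y x)]
    rw [integral_rectangle_add (u := fun y x => (t * t) * (u y x)^2)
        (v := fun y x => (2 * t) * (u y x * v y x) + (v y x)^2)
        (by simp only [Function.uncurry_def]; fun_prop)
        (by simp only [Function.uncurry_def]; fun_prop),
      integral_rectangle_add (u := fun y x => (2 * t) * (u y x * v y x))
        (v := fun y x => (v y x)^2)
        (by simp only [Function.uncurry_def]; fun_prop)
        (by simp only [Function.uncurry_def]; fun_prop)] at hnonneg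
    simp only [intervalIntegral.integral_const_mul] at hnonneg
    linarith
  rw [discrim] at key
  nlinarith

theorem intervalIntegral_swap_of_continuous {u : ℝ → ℝ → ℝ} (hu : Continuous u.uncurry)
    (a b c d : ℝ) :
    ∫ x in a..b, ∫ y in c..d, u x y = ∫ y in c..d, ∫ x in a..b, u x y := by
  apply MeasureTheory.intervalIntegral_intervalIntegral_swap
  refine (hu.continuousOn.integrableOn_compact
    ((isCompact_uIcc (a := a) (b := b)).prod (isCompact_uIcc (a := c) (b := d)))).mono_set
      (Set.prod_mono Set.uIoc_subset_uIcc Set.uIoc_subset_uIcc)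

/-- Moving the innermost integration of a triple integral to the outside. -/
theorem integral_rectangle_integral_swap {k : ℝ → ℝ → ℝ → ℝ}
    (hk : Continuous fun p : ℝ × ℝ × ℝ => k p.1 p.2.1 p.2.2) (a b c d e m : ℝ) :
    ∫ y in a..b, ∫ x in c..d, ∫ z in e..m, k x y z =
      ∫ z in e..m, ∫ y in a..b, ∫ x in c..d, k x y z := by
  have hinner : ∀ y, ∫ x in c..d, ∫ z in e..m, k x y z = ∫ z in e..m, ∫ x in c..d, k x y z :=
    fun y => intervalIntegral_swap_of_continuous (u := fun x z => k x y z)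
      (hk.comp (by fun_prop : Continuous fun p : ℝ × ℝ => (p.1, y, p.2))) _ _ _ _
  simp only [hinner]
  apply intervalIntegral_swap_of_continuous (u := fun y z => ∫ x in c..d, k x y z)
  exact intervalIntegral.continuous_parametric_intervalIntegral_of_continuous'
    (f := fun (p : ℝ × ℝ) x => k x p.1 p.2)
    (hk.comp (by fun_prop : Continuous fun p : (ℝ × ℝ) × ℝ => (p.2, p.1.1, p.1.2))) _ _

theorem Smooth3.hasDerivAt {f : ℝ → ℝ → ℝ → ℝ} (hf : Smooth3 f) (x y z : ℝ) :
    HasDerivAt (fun s => f x y s)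
      (fderiv ℝ (fun p : ℝ × ℝ × ℝ => f p.1 p.2.1 p.2.2) (x, y, z) (0, 0, 1)) z := by
  have h1 := ((hf.differentiable (by simp)) (x, y, z)).hasFDerivAt
  have h2 : HasDerivAt (fun s : ℝ => (x, y, s)) ((0 : ℝ), (0 : ℝ), (1 : ℝ)) z :=
    (hasDerivAt_const z x).prodMk ((hasDerivAt_const z y).prodMk (hasDerivAt_id z))
  exact h1.comp_hasDerivAt z h2

theorem Smooth3.hasDerivAt_pdz {f : ℝ → ℝ → ℝ → ℝ} (hf : Smooth3 f) (x y z : ℝ) :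
    HasDerivAt (fun s => f x y s) (pdz f x y z) z :=
  (hf.hasDerivAt x y z).differentiableAt.hasDerivAt

theorem Smooth3.continuous_pdz {f : ℝ → ℝ → ℝ → ℝ} (hf : Smooth3 f) :
    Continuous fun p : ℝ × ℝ × ℝ => pdz f p.1 p.2.1 p.2.2 := by
  have h : (fun p : ℝ × ℝ × ℝ => pdz f p.1 p.2.1 p.2.2) = fun p =>
      fderiv ℝ (fun p : ℝ × ℝ × ℝ => f p.1 p.2.1 p.2.2) p (0, 0, 1) :=
    funext fun p => (hf.hasDerivAt p.1 p.2.1 p.2.2).deriv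
  rw [h]
  exact (hf.continuous_fderiv (by simp)).clm_apply continuous_const

theorem continuous_horizontal_integral {k : ℝ → ℝ → ℝ → ℝ}
    (hk : Continuous fun p : ℝ × ℝ × ℝ => k p.1 p.2.1 p.2.2) (R : ℝ) :
    Continuous fun z => ∫ y in (0:ℝ)..R, ∫ x in (0:ℝ)..R, k x y z :=
  continuous_parametric_integral_rectangle (u := fun z y x => k x y z)
    (hk.comp (by fun_prop : Continuous fun p : (ℝ × ℝ) × ℝ => (p.2, p.1.2, p.1.1))) _ _ _ _

/-- Additivity of the integral over `Ω`, for continuous functions. -/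
theorem intOmega_add {u v : ℝ → ℝ → ℝ → ℝ} (L : ℝ)
    (hu : Continuous fun p : ℝ × ℝ × ℝ => u p.1 p.2.1 p.2.2)
    (hv : Continuous fun p : ℝ × ℝ × ℝ => v p.1 p.2.1 p.2.2) :
    intOmega L (fun x y z => u x y z + v x y z) = intOmega L u + intOmega L v := by
  unfold intOmega
  rw [← intervalIntegral.integral_add
    ((continuous_horizontal_integral hu _).intervalIntegrable _ _)
    ((continuous_horizontal_integral hv _).intervalIntegrable _ _)]
  refine intervalIntegral.integral_congr fun z _ => ?_
  exact integral_rectangle_add (u := fun y x => u x y z) (v := fun y x => v x y z)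
    (hu.comp (by fun_prop : Continuous fun p : ℝ × ℝ => (p.2, p.1, z)))
    (hv.comp (by fun_prop : Continuous fun p : ℝ × ℝ => (p.2, p.1, z))) _ _ _ _

/-- The horizontal `L²` norm at any height is controlled by the vertical `H¹` norm over `Ω`. -/
theorem Smooth3.horizontal_sq_le {f : ℝ → ℝ → ℝ → ℝ} (hf : Smooth3 f) {L : ℝ} (hL : 0 < L)
    {z : ℝ} (hz : z ∈ Set.Icc 0 (2*π)) :
    ∫ y in (0:ℝ)..(2*π*L), ∫ x in (0:ℝ)..(2*π*L), (f x y z)^2 ≤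
      (1/(2*π) + 1) * (l2sq L f + l2sq L (fun x y z => pdz f x y z)) := by
  have hfc : Continuous fun p : ℝ × ℝ × ℝ => f p.1 p.2.1 p.2.2 := hf.continuous
  have hdc := hf.continuous_pdz
  have hR : 0 ≤ 2*π*L := by positivity
  have hfc2 : Continuous fun p : ℝ × ℝ × ℝ => (f p.1 p.2.1 p.2.2)^2 := hfc.pow 2
  have hk : Continuous fun p : ℝ × ℝ × ℝ =>
      (f p.1 p.2.1 p.2.2)^2 + (pdz f p.1 p.2.1 p.2.2)^2 := by fun_prop
  have hck : Continuous fun p : ℝ × ℝ × ℝ =>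
      (1/(2*π) + 1) * ((f p.1 p.2.1 p.2.2)^2 + (pdz f p.1 p.2.1 p.2.2)^2) :=
    continuous_const.mul hk
  rw [l2sq, l2sq, ← intOmega_add L (hfc.pow 2) (hdc.pow 2), intOmega,
    ← integral_rectangle_integral_swap (k := fun x y z => (f x y z)^2 + (pdz f x y z)^2) hk]
  simp only [← intervalIntegral.integral_const_mul (1/(2*π) + 1)]
  refine integral_rectangle_mono (u := fun y x => (f x y z)^2)
    (v := fun y x => ∫ s in (0:ℝ)..(2*π), (1/(2*π) + 1) * ((f x y s)^2 + (pdz f x y s)^2))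
    (hfc2.comp (by fun_prop : Continuous fun p : ℝ × ℝ => (p.2, p.1, z))) ?_ hR hR ?_
  · exact intervalIntegral.continuous_parametric_intervalIntegral_of_continuous'
      (f := fun (p : ℝ × ℝ) s => (1/(2*π) + 1) * ((f p.2 p.1 s)^2 + (pdz f p.2 p.1 s)^2))
      (hck.comp
        (by fun_prop : Continuous fun p : (ℝ × ℝ) × ℝ => (p.1.2, p.1.1, p.2))) _ _
  · intro y x
    simp only [intervalIntegral.integral_const_mul]
    exact sq_le_sobolev_integral (hf.hasDerivAt_pdz x y)
      (hdc.comp (by fun_prop : Continuous fun s : ℝ => (x, y, s))) (by positivity) hz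

/-- Estimate for the horizontal mean of a product: `∫₀^{2π} (mean(fg))² dz ≤
C (‖f‖₂² + ‖∂_z f‖₂²) ‖g‖₂²`. -/
theorem mean_product_estimate (L : ℝ) (hL : 0 < L) :
    ∃ C : ℝ, 0 < C ∧ ∀ f g : ℝ → ℝ → ℝ → ℝ,
      Smooth3 f → OmegaPeriodic L f → Smooth3 g → OmegaPeriodic L g →
      (∫ z in (0:ℝ)..(2*π), (hmean L (fun x y z' => f x y z' * g x y z') z)^2)
        ≤ C * (l2sq L f + l2sq L (fun x y z => pdz f x y z)) * l2sq L g := by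
  refine ⟨(1/(4*π^2*L^2))^2 * (1/(2*π) + 1), by positivity, fun f g hf _ hg _ => ?_⟩
  have hfc : Continuous fun p : ℝ × ℝ × ℝ => f p.1 p.2.1 p.2.2 := hf.continuous
  have hgc : Continuous fun p : ℝ × ℝ × ℝ => g p.1 p.2.1 p.2.2 := hg.continuous
  have hR : 0 ≤ 2*π*L := by positivity
  set G : ℝ → ℝ := fun z => ∫ y in (0:ℝ)..(2*π*L), ∫ x in (0:ℝ)..(2*π*L), (g x y z)^2
  have hGc : Continuous G := continuous_horizontal_integral (hgc.pow 2) _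
  have hl2 : l2sq L g = ∫ z in (0:ℝ)..(2*π), G z := rfl
  have hfg : Continuous fun z => ∫ y in (0:ℝ)..(2*π*L), ∫ x in (0:ℝ)..(2*π*L),
      f x y z * g x y z := continuous_horizontal_integral (hfc.mul hgc) _
  rw [hl2, ← intervalIntegral.integral_const_mul]
  refine intervalIntegral.integral_mono_on (by positivity)
    (((continuous_const.mul hfg).pow 2).intervalIntegrable _ _)
    ((continuous_const.mul hGc).intervalIntegrable _ _) fun z hz => ?_
  have hslice : Continuous fun p : ℝ × ℝ => (p.2, p.1, z) := by fun_prop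
  have hcs := sq_integral_rectangle_mul_le (u := fun y x => f x y z) (v := fun y x => g x y z)
    (hfc.comp hslice) (hgc.comp hslice) hR hR
  have hG0 : 0 ≤ G z := intervalIntegral.integral_nonneg hR fun y _ =>
    intervalIntegral.integral_nonneg hR fun x _ => sq_nonneg _
  have hbound := hcs.trans (mul_le_mul_of_nonneg_right (hf.horizontal_sq_le hL hz) hG0)
  rw [hmean, mul_pow]
  exact (mul_le_mul_of_nonneg_left hbound (sq_nonneg _)).trans_eq (by ring)
end
end
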